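/- Let $R > 0$, let $\xi, M : (0,R] \to \mathbb{R}$ be differentiable with $\xi(r) > 0$ and $r - 2M(r) > 0$, let $p, \rho : (0,R] \to \mathbb{R}$ be continuous with $M'(r) = 4\pi r^2 \rho(r)$, and set $\lambda(r) = (1 - 2M(r)/r)^{-1/2}$. Then for each $r \in (0,R]$, the Euler–Lagrange equation $4\pi r\,\xi(r)\,(p(r)+\rho(r))\,\lambda(r)^3 - (\lambda\xi)'(r) = 0$ holds if and only if Einstein's field equation $\xi'(r) = \xi(r)\,\dfrac{M(r) + 4\pi r^3 p(r)}{r\,(r - 2M(r))}$ holds. -/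

import Mathlib

open Set Real

/-- The radial metric function `λ(r) = (1 - 2M(r)/r)^(-1/2)` of a static,
spherically symmetric metric with mass function `M`. -/
noncomputable def lamFn (M : ℝ → ℝ) (r : ℝ) : ℝ :=
  (Real.sqrt (1 - 2 * M r / r))⁻¹

theorem one_sub_two_mul_div_pos {M : ℝ → ℝ} {r : ℝ} (hr : 0 < r) (h : 0 < r - 2 * M r) :
    0 < 1 - 2 * M r / r := by
  rw [sub_pos, div_lt_one hr]
  linarith

theorem lamFn_sq {M : ℝ → ℝ} {r : ℝ} (hr : 0 < r) (h : 0 < r - 2 * M r) :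
    lamFn M r ^ 2 = r / (r - 2 * M r) := by
  have hu : 1 - 2 * M r / r = (r - 2 * M r) / r := by field_simp
  rw [lamFn, inv_pow, hu, Real.sq_sqrt (div_pos h hr).le, inv_div]

theorem lamFn_pos {M : ℝ → ℝ} {r : ℝ} (hr : 0 < r) (h : 0 < r - 2 * M r) :
    0 < lamFn M r :=
  inv_pos.2 (Real.sqrt_pos.2 (one_sub_two_mul_div_pos hr h))

theorem hasDerivAt_lamFn {M : ℝ → ℝ} {M' r : ℝ} (hr : 0 < r) (h : 0 < r - 2 * M r)
    (hM : HasDerivAt M M' r) :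
    HasDerivAt (lamFn M) (lamFn M r ^ 3 * (M' / r - M r / r ^ 2)) r := by
  have hu : 0 < 1 - 2 * M r / r := one_sub_two_mul_div_pos hr h
  have hs : 0 < Real.sqrt (1 - 2 * M r / r) := Real.sqrt_pos.2 hu
  have hd : HasDerivAt (fun x => 1 - 2 * M x / x)
      (-((2 * M' * r - 2 * M r * 1) / r ^ 2)) r :=
    ((hM.const_mul 2).div (hasDerivAt_id r) hr.ne').const_sub 1
  refine ((hd.sqrt hu.ne').inv hs.ne').congr_deriv ?_
  rw [lamFn]
  generalize Real.sqrt (1 - 2 * M r / r) = s at hs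
  field_simp

/-- The Euler–Lagrange equation `4π r ξ (p+ρ) λ³ - (λξ)' = 0` arising from the
extremization of the free energy is equivalent to Einstein's field equation
`ξ' = ξ (M + 4π r³ p)/(r(r - 2M))`. -/
theorem euler_lagrange_iff_einstein
    (R : ℝ) (hR : 0 < R) (ξ M p ρ : ℝ → ℝ)
    (hξd : ∀ r ∈ Ioc (0:ℝ) R, DifferentiableAt ℝ ξ r)
    (hMd : ∀ r ∈ Ioc (0:ℝ) R, DifferentiableAt ℝ M r)
    (hξpos : ∀ r ∈ Ioc (0:ℝ) R, 0 < ξ r)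
    (hhoriz : ∀ r ∈ Ioc (0:ℝ) R, 0 < r - 2 * M r)
    (hpc : ContinuousOn p (Ioc 0 R))
    (hρc : ContinuousOn ρ (Ioc 0 R))
    (hM' : ∀ r ∈ Ioc (0:ℝ) R, deriv M r = 4 * π * r ^ 2 * ρ r) :
    ∀ r ∈ Ioc (0:ℝ) R,
      (4 * π * r * ξ r * (p r + ρ r) * (lamFn M r) ^ 3
          - deriv (fun r' => lamFn M r' * ξ r') r = 0)
        ↔ deriv ξ r = ξ r * (M r + 4 * π * r ^ 3 * p r) / (r * (r - 2 * M r)) := by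
  intro r hr
  have hr0 : 0 < r := hr.1
  have hh := hhoriz r hr
  have hlam := lamFn_pos hr0 hh
  have hd := (hasDerivAt_lamFn hr0 hh (hMd r hr).hasDerivAt).mul (hξd r hr).hasDerivAt
  have hderiv : deriv (fun r' => lamFn M r' * ξ r') r = _ := hd.deriv
  have key : 4 * π * r * ξ r * (p r + ρ r) * lamFn M r ^ 3
      - deriv (fun r' => lamFn M r' * ξ r') r
      = lamFn M r *
        (ξ r * (M r + 4 * π * r ^ 3 * p r) / (r * (r - 2 * M r)) - deriv ξ r) := by
    have hcube : lamFn M r ^ 3 = lamFn M r * (r / (r - 2 * M r)) := by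
      rw [← lamFn_sq hr0 hh]
      ring
    rw [hderiv, hM' r hr, hcube]
    have hne := hh.ne'
    field_simp
    ring
  rw [key, mul_eq_zero, or_iff_right hlam.ne', sub_eq_zero, eq_comm]
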